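/- arXiv:2605.03265 — 3 statements merged into one kernel-verified Lean document; each statement's English description precedes it below -/
import Mathlib

section
/- Let U(x) = x/‖x‖ for x ∈ R^p \ {0} and L(x) = ‖x‖^{−1}( I_p − U(x)U(x)^T ). There is a universal constant C such that for every x ≠ 0 and every h with ‖h‖ ≤ ‖x‖/2, ‖ U(x+h) − U(x) − L(x)h ‖ ≤ C ‖h‖² ‖x‖^{−2}. Consequently, for a random vector Y ∈ R^p and deterministic h, E‖U(Y+h) − U(Y) − L(Y)h‖ ≤ C‖h‖² E‖Y‖^{−2} + 2 P(‖Y‖ ≤ 2‖h‖). -/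
open MeasureTheory

noncomputable section

/-- Euclidean norm of a vector in `ℝ^p`. -/
def euclNorm {p : ℕ} (v : Fin p → ℝ) : ℝ := Real.sqrt (∑ j, v j ^ 2)

/-- The spatial sign `U(x) = x / ‖x‖` for `x ≠ 0`, with `U(0) = 0`. -/
def spatialSign {p : ℕ} (v : Fin p → ℝ) : Fin p → ℝ := (euclNorm v)⁻¹ • v

/-- `L(x) h = ‖x‖⁻¹ (h − ⟨U(x), h⟩ U(x))`, i.e. `L(x) = ‖x‖⁻¹(I_p − U(x)U(x)ᵀ)`
applied to `h`; this is the Fréchet derivative of `U` at `x ≠ 0`. -/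
def signDeriv {p : ℕ} (x h : Fin p → ℝ) : Fin p → ℝ :=
  (euclNorm x)⁻¹ • (h - (∑ j, spatialSign x j * h j) • spatialSign x)

theorem norm_inv_norm_smul_le_one {E : Type*} [NormedAddCommGroup E] [NormedSpace ℝ E] (x : E) :
    ‖‖x‖⁻¹ • x‖ ≤ 1 := by
  rw [norm_smul, norm_inv, norm_norm]
  exact inv_mul_le_one

section InnerProduct

variable {E : Type*} [NormedAddCommGroup E] [InnerProductSpace ℝ E]

/-- Second-order expansion of `x ↦ ‖x‖⁻¹ • x` at a unit vector. -/
theorem norm_normalize_sub_linear_le_of_norm_eq_one (u k : E) (hu : ‖u‖ = 1) :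
    ‖‖u + k‖⁻¹ • (u + k) - u - (k - inner ℝ u k • u)‖ ≤ 12 * ‖k‖ ^ 2 := by
  have ha : |inner ℝ u k| ≤ ‖k‖ := by simpa [hu] using abs_real_inner_le_norm u k
  have hr := norm_nonneg k
  rcases le_total (1 / 2) ‖k‖ with hk | hk
  · have h1 := norm_inv_norm_smul_le_one (u + k)
    have h2 : ‖inner ℝ u k • u‖ ≤ ‖k‖ := by
      rw [norm_smul, hu, mul_one]
      exact ha
    have h3 := norm_sub_le (‖u + k‖⁻¹ • (u + k) - u) (k - inner ℝ u k • u)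
    have h4 := norm_sub_le (‖u + k‖⁻¹ • (u + k)) u
    have h5 := norm_sub_le k (inner ℝ u k • u)
    nlinarith
  · have hsq : ‖u + k‖ ^ 2 = 1 + 2 * inner ℝ u k + ‖k‖ ^ 2 := by
      rw [norm_add_sq_real, hu]
      ring
    have hm1 : |‖u + k‖ - 1| ≤ ‖k‖ := by
      simpa [hu] using abs_norm_sub_norm_le (u + k) u
    have hm : 1 / 2 ≤ ‖u + k‖ := by linarith [(abs_le.mp hm1).1]
    have hsplit : ‖u + k‖⁻¹ • (u + k) - u - (k - inner ℝ u k • u)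
        = (‖u + k‖⁻¹ - 1 + inner ℝ u k) • u + (‖u + k‖⁻¹ - 1) • k := by module
    rw [hsplit]
    generalize inner ℝ u k = a at *
    generalize ‖u + k‖ = m at *
    have hm0 : 0 < m := by linarith
    have hinv : |m⁻¹ - 1| ≤ 2 * ‖k‖ := by
      have : m⁻¹ - 1 = -(m - 1) / m := by field_simp; ring
      rw [this, abs_div, abs_neg, abs_of_pos hm0, div_le_iff₀ hm0]
      nlinarith
    have hcoef : |m⁻¹ - 1 + a| ≤ 5 * ‖k‖ ^ 2 := by
      have hden : 0 < m * (m + 1) := by positivity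
      have : m⁻¹ - 1 + a = (a * (m - 1) * (m + 2) - ‖k‖ ^ 2) / (m * (m + 1)) := by
        field_simp
        linear_combination -hsq
      rw [this, abs_div, abs_of_pos hden, div_le_iff₀ hden]
      have hprod : |a * (m - 1)| ≤ ‖k‖ ^ 2 := by
        rw [abs_mul, sq]
        exact mul_le_mul ha hm1 (abs_nonneg _) hr
      calc |a * (m - 1) * (m + 2) - ‖k‖ ^ 2|
          ≤ |a * (m - 1) * (m + 2)| + |‖k‖ ^ 2| := abs_sub _ _
        _ = |a * (m - 1)| * (m + 2) + ‖k‖ ^ 2 := by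
            rw [abs_mul, abs_of_pos (by linarith : 0 < m + 2), abs_of_nonneg (sq_nonneg ‖k‖)]
        _ ≤ ‖k‖ ^ 2 * (m + 2) + ‖k‖ ^ 2 := by gcongr
        _ = ‖k‖ ^ 2 * (m + 3) := by ring
        _ ≤ ‖k‖ ^ 2 * (5 * (m * (m + 1))) := by
            gcongr
            nlinarith
        _ = 5 * ‖k‖ ^ 2 * (m * (m + 1)) := by ring
    calc ‖(m⁻¹ - 1 + a) • u + (m⁻¹ - 1) • k‖
        ≤ |m⁻¹ - 1 + a| + |m⁻¹ - 1| * ‖k‖ := by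
          simpa [norm_smul, hu] using norm_add_le ((m⁻¹ - 1 + a) • u) ((m⁻¹ - 1) • k)
      _ ≤ 5 * ‖k‖ ^ 2 + 2 * ‖k‖ * ‖k‖ := by gcongr
      _ ≤ 12 * ‖k‖ ^ 2 := by nlinarith

/-- Second-order expansion of `x ↦ ‖x‖⁻¹ • x` at a nonzero vector, valid for all increments. -/
theorem norm_normalize_sub_linear_le (x h : E) (hx : x ≠ 0) :
    ‖‖x + h‖⁻¹ • (x + h) - ‖x‖⁻¹ • x
        - ‖x‖⁻¹ • (h - inner ℝ (‖x‖⁻¹ • x) h • ‖x‖⁻¹ • x)‖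
      ≤ 12 * ‖h‖ ^ 2 * (‖x‖ ^ 2)⁻¹ := by
  have hn : 0 < ‖x‖ := norm_pos_iff.mpr hx
  have key := norm_normalize_sub_linear_le_of_norm_eq_one (‖x‖⁻¹ • x) (‖x‖⁻¹ • h)
    (by rw [norm_smul, norm_inv, norm_norm, inv_mul_cancel₀ hn.ne'])
  have hnorm : ‖‖x‖⁻¹ • x + ‖x‖⁻¹ • h‖⁻¹ • (‖x‖⁻¹ • x + ‖x‖⁻¹ • h)
      = ‖x + h‖⁻¹ • (x + h) := by
    rw [← smul_add, norm_smul, norm_inv, norm_norm, smul_smul]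
    congr 1
    rw [mul_inv, inv_inv, mul_right_comm, mul_inv_cancel₀ hn.ne', one_mul]
  have hlin : ‖x‖⁻¹ • h - inner ℝ (‖x‖⁻¹ • x) (‖x‖⁻¹ • h) • ‖x‖⁻¹ • x
      = ‖x‖⁻¹ • (h - inner ℝ (‖x‖⁻¹ • x) h • ‖x‖⁻¹ • x) := by
    rw [real_inner_smul_right]
    module
  rw [hnorm, hlin] at key
  refine key.trans_eq ?_
  rw [norm_smul, norm_inv, norm_norm]
  ring

end InnerProduct

theorem euclNorm_eq_norm_toLp {p : ℕ} (v : Fin p → ℝ) : euclNorm v = ‖WithLp.toLp 2 v‖ := by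
  simp [euclNorm, EuclideanSpace.norm_eq]

theorem toLp_spatialSign {p : ℕ} (v : Fin p → ℝ) :
    WithLp.toLp 2 (spatialSign v) = ‖WithLp.toLp 2 v‖⁻¹ • WithLp.toLp 2 v := by
  rw [spatialSign, euclNorm_eq_norm_toLp, WithLp.toLp_smul]

theorem sum_mul_eq_inner_toLp {p : ℕ} (v w : Fin p → ℝ) :
    ∑ j, v j * w j = inner ℝ (WithLp.toLp 2 v) (WithLp.toLp 2 w) := by
  simp [PiLp.inner_apply, mul_comm]

theorem euclNorm_spatialSign_remainder_le {p : ℕ} (x h : Fin p → ℝ) (hx : x ≠ 0) :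
    euclNorm (spatialSign (x + h) - spatialSign x - signDeriv x h)
      ≤ 12 * euclNorm h ^ 2 * (euclNorm x ^ 2)⁻¹ := by
  have hx' : WithLp.toLp 2 x ≠ 0 := by simpa using hx
  have key := norm_normalize_sub_linear_le (WithLp.toLp 2 x) (WithLp.toLp 2 h) hx'
  simpa only [euclNorm_eq_norm_toLp, signDeriv, sum_mul_eq_inner_toLp, WithLp.toLp_sub,
    WithLp.toLp_smul, toLp_spatialSign, WithLp.toLp_add] using key

theorem euclNorm_spatialSign_remainder_zero_le {p : ℕ} (h : Fin p → ℝ) :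
    euclNorm (spatialSign (0 + h) - spatialSign 0 - signDeriv 0 h) ≤ 1 := by
  have h0 : euclNorm (0 : Fin p → ℝ) = 0 := by simp [euclNorm]
  have : spatialSign (0 + h) - spatialSign 0 - signDeriv 0 h = spatialSign h := by
    simp [signDeriv, h0, spatialSign]
  rw [this, euclNorm_eq_norm_toLp, toLp_spatialSign]
  exact norm_inv_norm_smul_le_one _

/-- There is a universal constant `C` such that for every dimension `p`,
every `x ≠ 0` and every `h` with `‖h‖ ≤ ‖x‖/2`,
`‖U(x+h) − U(x) − L(x)h‖ ≤ C ‖h‖² ‖x‖⁻²`; consequently, for every random vector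
`Y` on a probability space and every deterministic `h`,
`E‖U(Y+h) − U(Y) − L(Y)h‖ ≤ C ‖h‖² E‖Y‖⁻² + 2 P(‖Y‖ ≤ 2‖h‖)`
(stated with lower integrals so that no integrability side conditions are needed). -/
theorem sign_second_order_bound :
    ∃ C : ℝ, 0 < C ∧
      (∀ (p : ℕ) (x h : Fin p → ℝ), x ≠ 0 → euclNorm h ≤ euclNorm x / 2 →
        euclNorm (spatialSign (x + h) - spatialSign x - signDeriv x h)
          ≤ C * euclNorm h ^ 2 * (euclNorm x ^ 2)⁻¹) ∧
      (∀ (p : ℕ) (Ω : Type) (_ : MeasurableSpace Ω) (μ : Measure Ω),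
        IsProbabilityMeasure μ → ∀ (Y : Ω → Fin p → ℝ) (h : Fin p → ℝ),
        (∫⁻ ω, ENNReal.ofReal
            (euclNorm (spatialSign (Y ω + h) - spatialSign (Y ω) - signDeriv (Y ω) h)) ∂μ)
          ≤ ENNReal.ofReal (C * euclNorm h ^ 2) * (∫⁻ ω, ENNReal.ofReal ((euclNorm (Y ω) ^ 2)⁻¹) ∂μ)
            + 2 * μ {ω | euclNorm (Y ω) ≤ 2 * euclNorm h}) := by
  refine ⟨12, by norm_num, fun p x h hx _ => euclNorm_spatialSign_remainder_le x h hx, ?_⟩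
  intro p Ω _ μ _ Y h
  -- `Y` need not be measurable, so the event is replaced by its measurable hull.
  set A : Set Ω := {ω | euclNorm (Y ω) ≤ 2 * euclNorm h} with hA
  set B : Set Ω := toMeasurable μ A
  have hB : MeasurableSet B := measurableSet_toMeasurable μ A
  calc _ ≤ ∫⁻ ω, (ENNReal.ofReal (12 * euclNorm h ^ 2) * ENNReal.ofReal ((euclNorm (Y ω) ^ 2)⁻¹)
          + B.indicator (fun _ => 2) ω) ∂μ := by
        refine lintegral_mono fun ω => ?_
        by_cases hY : Y ω = 0
        · have hω : ω ∈ B := by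
            refine subset_toMeasurable μ A ?_
            simp [hA, hY, euclNorm]
          rw [Set.indicator_of_mem hω, hY]
          refine le_add_left ?_
          calc _ ≤ ENNReal.ofReal 1 :=
                ENNReal.ofReal_le_ofReal (euclNorm_spatialSign_remainder_zero_le h)
            _ ≤ 2 := by simp
        · refine le_add_right ?_
          rw [← ENNReal.ofReal_mul (by positivity)]
          exact ENNReal.ofReal_le_ofReal (euclNorm_spatialSign_remainder_le _ _ hY)
    _ = _ := by
        rw [lintegral_add_right _ (measurable_const.indicator hB),
          lintegral_const_mul' _ _ ENNReal.ofReal_ne_top, lintegral_indicator_const hB,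
          measure_toMeasurable]

end
end

section
/- Under the null hypothesis θ_1 = θ_2 and Assumptions (A1)–(A3), there exist constants C, c > 0 such that for every sufficiently large M with M r_D ≤ ε_F/q_+: P( max_{k=1,2} max_{1≤j≤p} | q̂_{kj,α}/d_{kj}^{1/2} − 1 | > M r_D ) ≤ C exp( −c M² x_N + log p ), where r_D = (x_N/n_0)^{1/2}, x_N = log(8pN), n_0 = min(n_1,n_2). -/
open MeasureTheory ProbabilityTheory Matrix Filter

noncomputable section

namespace PDQ

/-- Euclidean norm of a vector in `ℝ^p`. -/
def enorm {p : ℕ} (v : Fin p → ℝ) : ℝ := Real.sqrt (∑ j, v j ^ 2)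

/-- The spatial sign `U(x) = x/‖x‖` (`U(0) = 0`). -/
def sgn {p : ℕ} (v : Fin p → ℝ) : Fin p → ℝ := (enorm v)⁻¹ • v

/-- Operator (spectral) norm of a real matrix. -/
def opNorm {p q : ℕ} (A : Matrix (Fin p) (Fin q) ℝ) : ℝ :=
  sSup ((fun v => enorm (A.mulVec v)) '' {v : Fin q → ℝ | enorm v ≤ 1})

/-- Symmetrization `sym(A) = (A + Aᵀ)/2`. -/
def symPart {p : ℕ} (A : Matrix (Fin p) (Fin p) ℝ) : Matrix (Fin p) (Fin p) ℝ :=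
  (2 : ℝ)⁻¹ • (A + Aᵀ)

/-- The two-sample elliptical model
`X_{ki} = θ_k + (D_k°)^{1/2} R_k^{1/2} ξ_{ki} u_{ki}`, `k = 0, 1` (samples 1 and 2),
with i.i.d. observations within each sample, mutual independence of all the pairs
`(ξ_{ki}, u_{ki})`, `u_{ki}` uniform on the unit sphere `S^{p−1}` (characterized by unit
norm and rotation invariance of its law) independent of the positive radial
variable `ξ_{ki}`, `D_k°` a positive diagonal matrix, and `R_k` a positive definite
correlation matrix given through a square root `Rhalf k`. -/
structure Model (Ω : Type) [MeasurableSpace Ω] where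
  p : ℕ
  hp : 0 < p
  n : Fin 2 → ℕ
  hn : ∀ k, 2 ≤ n k
  μ : Measure Ω
  hμ : IsProbabilityMeasure μ
  θ : Fin 2 → Fin p → ℝ
  d0 : Fin 2 → Fin p → ℝ
  hd0 : ∀ k j, 0 < d0 k j
  Rhalf : Fin 2 → Matrix (Fin p) (Fin p) ℝ
  hRdiag : ∀ k j, (Rhalf k * (Rhalf k)ᵀ) j j = 1
  hRpd : ∀ k, (Rhalf k * (Rhalf k)ᵀ).PosDef
  ξ : (k : Fin 2) → Fin (n k) → Ω → ℝ
  u : (k : Fin 2) → Fin (n k) → Ω → Fin p → ℝ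
  hmξ : ∀ k i, Measurable (ξ k i)
  hmu : ∀ k i, Measurable (u k i)
  hξpos : ∀ k i, ∀ᵐ ω ∂μ, 0 < ξ k i ω
  hunit : ∀ k i, ∀ᵐ ω ∂μ, ∑ j, u k i ω j ^ 2 = 1
  hrot : ∀ k i (Q : Matrix (Fin p) (Fin p) ℝ), Q * Qᵀ = 1 →
    μ.map (fun ω => Q.mulVec (u k i ω)) = μ.map (u k i)
  hξu : ∀ k i, IndepFun (ξ k i) (u k i) μ
  hindep : iIndepFun
    (fun ki : (k : Fin 2) × Fin (n k) => fun ω => (ξ ki.1 ki.2 ω, u ki.1 ki.2 ω)) μ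
  hident : ∀ k i i', IdentDistrib (fun ω => (ξ k i ω, u k i ω))
    (fun ω => (ξ k i' ω, u k i' ω)) μ μ

namespace Model

variable {Ω : Type} [MeasurableSpace Ω] (M : Model Ω)

/-- The null hypothesis `θ_1 = θ_2`. -/
def H0 : Prop := M.θ 0 = M.θ 1

/-- First observation index in sample `k`. -/
def o0 (k : Fin 2) : Fin (M.n k) := ⟨0, lt_of_lt_of_le (by norm_num) (M.hn k)⟩

/-- Second observation index in sample `k`. -/
def o1 (k : Fin 2) : Fin (M.n k) := ⟨1, lt_of_lt_of_le (by norm_num) (M.hn k)⟩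

/-- First coordinate index. -/
def j0 : Fin M.p := ⟨0, M.hp⟩

/-- The observations: `X_{ki} = θ_k + (D_k°)^{1/2} R_k^{1/2} (ξ_{ki} u_{ki})`. -/
def X (k : Fin 2) (i : Fin (M.n k)) (ω : Ω) : Fin M.p → ℝ := fun j =>
  M.θ k j + Real.sqrt (M.d0 k j) * (M.Rhalf k).mulVec (fun m => M.ξ k i ω * M.u k i ω m) j

/-- `Z_{ki} = ξ_{ki} e₁ᵀ u_{ki}`. -/
def Z (k : Fin 2) (i : Fin (M.n k)) (ω : Ω) : ℝ := M.ξ k i ω * M.u k i ω M.j0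

/-- `F_{k,Δ}(t) = P(|Z_{k1} − Z_{k2}| ≤ t)` for independent copies of `ξ e₁ᵀu`. -/
def Fdelta (k : Fin 2) (t : ℝ) : ℝ :=
  (M.μ {ω | |M.Z k (M.o0 k) ω - M.Z k (M.o1 k) ω| ≤ t}).toReal

/-- The population `α`-quantile `q_{k,α} = F_{k,Δ}^{−1}(α)`. -/
def qA (α : ℝ) (k : Fin 2) : ℝ := sInf {t : ℝ | 0 ≤ t ∧ α ≤ M.Fdelta k t}

/-- The diagonal target `d_{kj} = q_{k,α}² d°_{kj}`. -/
def dT (α : ℝ) (k : Fin 2) (j : Fin M.p) : ℝ := (M.qA α k) ^ 2 * M.d0 k j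

/-- Empirical pairwise-difference CDF `F̂_{kj}`. -/
def Fhat (k : Fin 2) (j : Fin M.p) (t : ℝ) (ω : Ω) : ℝ :=
  ((M.n k).choose 2 : ℝ)⁻¹ *
    ∑ i : Fin (M.n k), ∑ l : Fin (M.n k),
      if i < l then (if |M.X k i ω j - M.X k l ω j| ≤ t then (1 : ℝ) else 0) else 0

/-- The pairwise-difference quantile estimator `q̂_{kj,α}`. -/
def qhat (α : ℝ) (k : Fin 2) (j : Fin M.p) (ω : Ω) : ℝ :=
  sInf {t : ℝ | 0 ≤ t ∧ α ≤ M.Fhat k j t ω}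

/-- The diagonal scale estimator `d̂_{kj} = q̂_{kj,α}²`. -/
def dhat (α : ℝ) (k : Fin 2) (j : Fin M.p) (ω : Ω) : ℝ := (M.qhat α k j ω) ^ 2

/-- `N = n₁ + n₂`. -/
def NN : ℕ := M.n 0 + M.n 1

/-- `n₀ = min(n₁, n₂)`. -/
def n0 : ℕ := min (M.n 0) (M.n 1)

/-- `x_N = log(8 p N)`. -/
def xN : ℝ := Real.log (8 * M.p * M.NN)

/-- `r_D = (x_N / n₀)^{1/2}`. -/
def rD : ℝ := Real.sqrt (M.xN / M.n0)

end Model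

/-- Assumption (A1): `n₁/N → κ ∈ (0,1)` and `x_N/n₀ → 0`. -/
def A1 {Ω : Type} [MeasurableSpace Ω] (Ms : ℕ → Model Ω) : Prop :=
  (∃ κ : ℝ, 0 < κ ∧ κ < 1 ∧
    Tendsto (fun ν => ((Ms ν).n 0 : ℝ) / ((Ms ν).NN : ℝ)) atTop (nhds κ)) ∧
  Tendsto (fun ν => (Ms ν).xN / ((Ms ν).n0 : ℝ)) atTop (nhds 0)

/-- Assumption (A2): uniformly bounded positive diagonal entries
(the i.i.d. elliptical sampling scheme is part of `Model`). -/
def A2 {Ω : Type} [MeasurableSpace Ω] (Ms : ℕ → Model Ω) : Prop :=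
  ∃ dlo dhi : ℝ, 0 < dlo ∧
    ∀ ν k j, dlo ≤ (Ms ν).d0 k j ∧ (Ms ν).d0 k j ≤ dhi

/-- Assumption (A3): quantile regularity, uniformly along the sequence. -/
def A3 {Ω : Type} [MeasurableSpace Ω] (α : ℝ) (Ms : ℕ → Model Ω) : Prop :=
  ∃ qlo qhi cF CF εF : ℝ, 0 < qlo ∧ qlo < qhi ∧ 0 < cF ∧ 0 < εF ∧
    ∀ ν k, (qlo ≤ (Ms ν).qA α k ∧ (Ms ν).qA α k ≤ qhi) ∧
      ∀ t : ℝ, |t - (Ms ν).qA α k| ≤ εF →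
        cF * |t - (Ms ν).qA α k| ≤ |(Ms ν).Fdelta k t - α| ∧
        |(Ms ν).Fdelta k t - α| ≤ CF * |t - (Ms ν).qA α k|

end PDQ

namespace PDQ

section UStatistic

variable {Ω : Type*} [MeasurableSpace Ω] {μ : Measure Ω}

/-- A sum of sub-Gaussian variables with a common parameter, without any independence. -/
lemma hasSubgaussianMGF_sum_of_common [IsProbabilityMeasure μ] {κ : Type*} (s : Finset κ)
    {W : κ → Ω → ℝ} {c : NNReal} (hW : ∀ i ∈ s, HasSubgaussianMGF (W i) c μ) :
    HasSubgaussianMGF (fun ω => ∑ i ∈ s, W i ω) ((s.card : NNReal) ^ 2 * c) μ := by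
  classical
  induction s using Finset.induction_on with
  | empty => simp
  | insert i s his ih =>
    have h := (hW i (Finset.mem_insert_self _ _)).add
      (ih fun r hr => hW r (Finset.mem_insert_of_mem hr))
    simp_rw [Finset.sum_insert his]
    convert h using 1
    rw [Finset.card_insert_of_notMem his, NNReal.sqrt_mul, NNReal.sqrt_sq]
    push_cast
    have : NNReal.sqrt c ^ 2 = c := NNReal.sq_sqrt c
    calc ((s.card : NNReal) + 1) ^ 2 * c = ((s.card : NNReal) + 1) ^ 2 * NNReal.sqrt c ^ 2 := by
          rw [this]
      _ = _ := by ring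

/-- A sum of sub-Gaussian functions of disjoint pairs of independent variables. -/
lemma hasSubgaussianMGF_sum_of_disjoint_pairs [IsProbabilityMeasure μ]
    {E ι κ : Type*} [MeasurableSpace E] {Y : ι → Ω → E} (hind : iIndepFun Y μ)
    (hY : ∀ i, Measurable (Y i)) {h : E × E → ℝ} (hh : Measurable h) {a b : κ → ι}
    (ha : Function.Injective a) (hb : Function.Injective b) (hab : ∀ r r', a r ≠ b r')
    {c : NNReal} (s : Finset κ)
    (hc : ∀ r ∈ s, HasSubgaussianMGF (fun ω => h (Y (a r) ω, Y (b r) ω)) c μ) :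
    HasSubgaussianMGF (fun ω => ∑ r ∈ s, h (Y (a r) ω, Y (b r) ω)) (s.card * c) μ := by
  classical
  induction s using Finset.induction_on with
  | empty => simp
  | insert r s hrs ih =>
    simp_rw [Finset.sum_insert hrs]
    rw [Finset.card_insert_of_notMem hrs, Nat.cast_succ, add_mul, one_mul, add_comm]
    refine (hc r (Finset.mem_insert_self _ _)).add_of_indepFun
      (ih fun r' hr' => hc r' (Finset.mem_insert_of_mem hr')) ?_
    let S : Finset ι := {a r, b r}
    let T : Finset ι := s.image a ∪ s.image b
    have hdisj : Disjoint S T := by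
      have key : ∀ r' ∈ s, r' ≠ r := fun r' hr' e => hrs (e ▸ hr')
      rw [Finset.disjoint_left]
      intro x hx hx'
      simp only [S, T, Finset.mem_insert, Finset.mem_singleton, Finset.mem_union,
        Finset.mem_image] at hx hx'
      rcases hx with rfl | rfl <;> rcases hx' with ⟨r', hr', e⟩ | ⟨r', hr', e⟩
      · exact key r' hr' (ha e)
      · exact hab r r' e.symm
      · exact hab r' r e
      · exact key r' hr' (hb e)
    have haT : ∀ r' ∈ s, a r' ∈ T := fun r' hr' =>
      Finset.mem_union_left _ (Finset.mem_image_of_mem _ hr')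
    have hbT : ∀ r' ∈ s, b r' ∈ T := fun r' hr' =>
      Finset.mem_union_right _ (Finset.mem_image_of_mem _ hr')
    have hST := (hind.indepFun_finset S T hdisj hY).comp
      (φ := fun x : S → E => h (x ⟨a r, by simp [S]⟩, x ⟨b r, by simp [S]⟩))
      (ψ := fun x : T → E => ∑ r' : s, h (x ⟨a r', haT r' r'.2⟩, x ⟨b r', hbT r' r'.2⟩))
      (by fun_prop) (by fun_prop)
    convert hST using 1
    · rfl
    ext ω
    exact (Finset.sum_coe_sort s fun r' => h (Y (a r') ω, Y (b r') ω)).symm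

lemma cast_card_offDiag_univ (ι : Type*) [Fintype ι] [DecidableEq ι] :
    ((Finset.univ : Finset ι).offDiag.card : ℝ) =
      (Fintype.card ι : ℝ) * (Fintype.card ι - 1) := by
  rw [Finset.offDiag_card, Finset.card_univ, Nat.cast_sub (Nat.le_mul_self _)]
  push_cast
  ring

/-- The sum over all permutations of a function of the images of two fixed distinct points. -/
lemma sum_perm_apply_pair {ι : Type*} [Fintype ι] [DecidableEq ι] (f : ι → ι → ℝ) {a b : ι}
    (hab : a ≠ b) :
    ((Fintype.card ι : ℝ) * (Fintype.card ι - 1)) * ∑ σ : Equiv.Perm ι, f (σ a) (σ b) =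
      (Fintype.card ι).factorial * ∑ z ∈ (Finset.univ : Finset ι).offDiag, f z.1 z.2 := by
  have hconst : ∀ z ∈ (Finset.univ : Finset ι).offDiag,
      ∑ σ : Equiv.Perm ι, f (σ z.1) (σ z.2) = ∑ σ : Equiv.Perm ι, f (σ a) (σ b) := by
    rintro ⟨x, y⟩ hz
    have hxy : x ≠ y := by simpa using hz
    obtain ⟨τ, h1, h2⟩ := (MulAction.is_two_pretransitive_iff (G := Equiv.Perm ι)).1
      (Equiv.Perm.isMultiplyPretransitive ι 2) hab hxy
    rw [Equiv.Perm.smul_def] at h1 h2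
    refine Fintype.sum_equiv (Equiv.mulRight τ) _ _ fun σ => ?_
    simp [h1, h2]
  have hperm : ∀ σ : Equiv.Perm ι, ∑ z ∈ (Finset.univ : Finset ι).offDiag, f (σ z.1) (σ z.2) =
      ∑ z ∈ (Finset.univ : Finset ι).offDiag, f z.1 z.2 := fun σ =>
    Finset.sum_equiv (σ.prodCongr σ) (by simp) (by simp)
  calc _ = ∑ z ∈ (Finset.univ : Finset ι).offDiag, ∑ σ : Equiv.Perm ι, f (σ z.1) (σ z.2) := by
        rw [Finset.sum_congr rfl hconst, Finset.sum_const, nsmul_eq_mul,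
          cast_card_offDiag_univ]
    _ = _ := by
        rw [Finset.sum_comm, Finset.sum_congr rfl fun σ _ => hperm σ, Finset.sum_const,
          nsmul_eq_mul, Finset.card_univ, Fintype.card_perm]

/-- Hoeffding's sub-Gaussian bound for second-order U-statistics with a `[0, 1]`-valued kernel. -/
lemma hasSubgaussianMGF_uStatistic [IsProbabilityMeasure μ] {E : Type*} [MeasurableSpace E]
    {n : ℕ} (hn : 2 ≤ n) {Y : Fin n → Ω → E} (hind : iIndepFun Y μ)
    (hY : ∀ i, Measurable (Y i)) {h : E × E → ℝ} (hh : Measurable h)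
    (h01 : ∀ z, h z ∈ Set.Icc (0 : ℝ) 1) {m : ℝ}
    (hm : ∀ i l, i ≠ l → ∫ ω, h (Y i ω, Y l ω) ∂μ = m) :
    HasSubgaussianMGF (fun ω => ((n : ℝ) * (n - 1))⁻¹ *
        ∑ z ∈ (Finset.univ : Finset (Fin n)).offDiag, (h (Y z.1 ω, Y z.2 ω) - m))
      (4 * (n / 2 : ℕ) : NNReal)⁻¹ μ := by
  have hpos : 0 < n / 2 := by omega
  let a : Fin (n / 2) → Fin n := fun r => ⟨2 * r, by omega⟩
  let b : Fin (n / 2) → Fin n := fun r => ⟨2 * r + 1, by omega⟩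
  have ha : Function.Injective a := fun r r' e => by
    have := congrArg Fin.val e; simp only [a] at this; omega
  have hb : Function.Injective b := fun r r' e => by
    have := congrArg Fin.val e; simp only [b] at this; omega
  have hab : ∀ r r', a r ≠ b r' := fun r r' e => by
    have := congrArg Fin.val e; simp only [a, b] at this; omega
  have hpair : ∀ i l, i ≠ l → HasSubgaussianMGF (fun ω => h (Y i ω, Y l ω) - m) 4⁻¹ μ := by
    intro i l hil
    have := hasSubgaussianMGF_of_mem_Icc (μ := μ) (X := fun ω => h (Y i ω, Y l ω))
      (a := 0) (b := 1) (by fun_prop) (ae_of_all _ fun ω => h01 _)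
    rw [hm i l hil] at this
    convert this using 1
    simp; norm_num
  have hblock : ∀ σ : Equiv.Perm (Fin n), HasSubgaussianMGF
      (fun ω => ∑ r, (h (Y (σ (a r)) ω, Y (σ (b r)) ω) - m)) ((n / 2 : ℕ) * 4⁻¹) μ := by
    intro σ
    have := hasSubgaussianMGF_sum_of_disjoint_pairs (h := fun z => h z - m) hind hY
      (hh.sub_const m) (σ.injective.comp ha) (σ.injective.comp hb)
      (fun r r' e => hab r r' (σ.injective e)) Finset.univ
      (fun r _ => hpair _ _ fun e => hab r r (σ.injective e))
    simpa using this
  have hsum := (hasSubgaussianMGF_sum_of_common Finset.univ fun σ _ => hblock σ).const_mul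
    (((n / 2 : ℕ) : ℝ) * n.factorial)⁻¹
  have hn1 : (0 : ℝ) < n - 1 := by
    have : (2 : ℝ) ≤ n := by exact_mod_cast hn
    linarith
  convert hsum using 1
  · ext ω
    rw [Finset.sum_comm]
    have key : ∀ r, ∑ σ : Equiv.Perm (Fin n), (h (Y (σ (a r)) ω, Y (σ (b r)) ω) - m) =
        ((n : ℝ) * (n - 1))⁻¹ * (n.factorial *
          ∑ z ∈ (Finset.univ : Finset (Fin n)).offDiag, (h (Y z.1 ω, Y z.2 ω) - m)) := by
      intro r
      have := sum_perm_apply_pair (fun i l => h (Y i ω, Y l ω) - m) (hab r r)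
      rw [Fintype.card_fin] at this
      rw [← this]
      field_simp
    rw [Finset.sum_congr rfl fun r _ => key r, Finset.sum_const, Finset.card_univ,
      Fintype.card_fin, nsmul_eq_mul]
    have : (n.factorial : ℝ) ≠ 0 := by positivity
    field_simp
  · rw [Finset.card_univ, Fintype.card_perm, Fintype.card_fin]
    apply NNReal.coe_injective
    have : (n.factorial : ℝ) ≠ 0 := by positivity
    have : ((n / 2 : ℕ) : ℝ) ≠ 0 := by positivity
    change _ = (((n / 2 : ℕ) : ℝ) * n.factorial)⁻¹ ^ 2 *
      (((n.factorial : NNReal) ^ 2 * ((n / 2 : ℕ) * 4⁻¹) : NNReal) : ℝ)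
    push_cast
    field_simp

end UStatistic

/-- Every unit vector is a prescribed row of some orthogonal matrix. -/
lemma exists_orthogonal_row_eq {p : ℕ} (i : Fin p) (a : Fin p → ℝ) (ha : ∑ m, a m * a m = 1) :
    ∃ Q : Matrix (Fin p) (Fin p) ℝ, Q * Qᵀ = 1 ∧ ∀ m, Q i m = a m := by
  have hv : Orthonormal ℝ (({i} : Set (Fin p)).domRestrict
      fun _ => (WithLp.toLp 2 a : EuclideanSpace ℝ (Fin p))) := by
    refine ⟨fun x => ?_, fun x y hxy => (hxy (Subsingleton.elim x y)).elim⟩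
    simp [EuclideanSpace.norm_eq, sq, ha]
  obtain ⟨b, hb⟩ := hv.exists_orthonormalBasis_extension_of_card_eq (by simp)
  refine ⟨Matrix.of fun l m => b l m, ?_, fun m => by simp [hb i rfl]⟩
  ext l l'
  have := orthonormal_iff_ite.1 b.orthonormal l' l
  rw [PiLp.inner_apply] at this
  simpa [Matrix.mul_apply, Matrix.one_apply, eq_comm] using this

/-- Averages of a symmetric array over ordered pairs and over unordered pairs agree. -/
lemma inv_choose_two_mul_sum {n : ℕ} (f : Fin n → Fin n → ℝ) (hf : ∀ i l, f i l = f l i) :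
    ((n.choose 2 : ℕ) : ℝ)⁻¹ * ∑ i, ∑ l, (if i < l then f i l else 0) =
      ((n : ℝ) * (n - 1))⁻¹ * ∑ z ∈ (Finset.univ : Finset (Fin n)).offDiag, f z.1 z.2 := by
  have hswap : ∑ i, ∑ l, (if i < l then f i l else 0) =
      ∑ i, ∑ l, (if l < i then f i l else 0) := by
    rw [Finset.sum_comm]
    simp_rw [fun i l => hf l i]
  have hsplit : ∑ z ∈ (Finset.univ : Finset (Fin n)).offDiag, f z.1 z.2 =
      2 * ∑ i, ∑ l, (if i < l then f i l else 0) := by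
    have : (Finset.univ : Finset (Fin n)).offDiag =
        Finset.univ.filter fun z : Fin n × Fin n => z.1 ≠ z.2 := by ext; simp
    rw [this, Finset.sum_filter, Fintype.sum_prod_type, two_mul]
    nth_rewrite 2 [hswap]
    simp_rw [← Finset.sum_add_distrib]
    refine Finset.sum_congr rfl fun i _ => Finset.sum_congr rfl fun l _ => ?_
    rcases lt_trichotomy i l with h | h | h
    · simp [h, h.ne, h.not_gt]
    · simp [h]
    · simp [h, h.ne', h.not_gt]
  rw [hsplit, Nat.cast_choose_two, inv_div, div_eq_mul_inv]
  ring

namespace Model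

variable {Ω : Type} [MeasurableSpace Ω] (M : Model Ω)

/-- The centred and scaled coordinate `e_jᵀ R_k^{1/2} ξ_{ki} u_{ki}`. -/
def Y (k : Fin 2) (j : Fin M.p) (i : Fin (M.n k)) (ω : Ω) : ℝ :=
  (M.Rhalf k).mulVec (fun m => M.ξ k i ω * M.u k i ω m) j

lemma measurable_Y (k : Fin 2) (j : Fin M.p) (i : Fin (M.n k)) : Measurable (M.Y k j i) := by
  have h1 := M.hmξ k i
  have h2 := measurable_pi_iff.1 (M.hmu k i)
  unfold Y Matrix.mulVec dotProduct
  fun_prop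

lemma iIndepFun_comp_sample (k : Fin 2) {g : ℝ × (Fin M.p → ℝ) → ℝ} (hg : Measurable g) :
    iIndepFun (fun i ω => g (M.ξ k i ω, M.u k i ω)) M.μ :=
  (M.hindep.precomp (g := fun i : Fin (M.n k) => (⟨k, i⟩ : (k : Fin 2) × Fin (M.n k)))
    fun _ _ h => eq_of_heq (Sigma.mk.inj h).2).comp (fun _ => g) fun _ => hg

lemma iIndepFun_Y (k : Fin 2) (j : Fin M.p) : iIndepFun (M.Y k j) M.μ :=
  M.iIndepFun_comp_sample k (g := fun z => (M.Rhalf k).mulVec (fun m => z.1 * z.2 m) j) (by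
    unfold Matrix.mulVec dotProduct
    fun_prop)

lemma iIndepFun_Z (k : Fin 2) : iIndepFun (M.Z k) M.μ :=
  M.iIndepFun_comp_sample k (g := fun z => z.1 * z.2 M.j0) (by fun_prop)

/-- Rotation invariance: every scaled coordinate has the law of `ξ e₁ᵀu`. -/
lemma identDistrib_Y_Z (k : Fin 2) (j : Fin M.p) (i i' : Fin (M.n k)) :
    IdentDistrib (M.Y k j i) (M.Z k i') M.μ M.μ := by
  have := M.hμ
  obtain ⟨Q, hQ, hrow⟩ := exists_orthogonal_row_eq M.j0 (M.Rhalf k j) (by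
    simpa [Matrix.mul_apply] using M.hRdiag k j)
  have hQm : Measurable fun v : Fin M.p → ℝ => Q.mulVec v := by
    unfold Matrix.mulVec dotProduct
    fun_prop
  have hrot : IdentDistrib (fun ω => Q.mulVec (M.u k i ω)) (M.u k i) M.μ M.μ :=
    ⟨(hQm.comp (M.hmu k i)).aemeasurable, (M.hmu k i).aemeasurable, M.hrot k i Q hQ⟩
  have hpair := (IdentDistrib.refl (M.hmξ k i).aemeasurable).prodMk hrot
    ((M.hξu k i).comp measurable_id hQm) (M.hξu k i)
  have h := (hpair.trans (M.hident k i i')).comp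
    (u := fun z : ℝ × (Fin M.p → ℝ) => z.1 * z.2 M.j0) (by fun_prop)
  have hY : M.Y k j i = (fun z : ℝ × (Fin M.p → ℝ) => z.1 * z.2 M.j0) ∘
      fun ω => (M.ξ k i ω, Q.mulVec (M.u k i ω)) := by
    ext ω
    simp only [Y, Matrix.mulVec, dotProduct, Function.comp, hrow, Finset.mul_sum]
    exact Finset.sum_congr rfl fun m _ => by ring
  rw [hY]
  exact h

/-- The kernel `1{|x − y| ≤ t}`. -/
def closeKernel (t : ℝ) (z : ℝ × ℝ) : ℝ := if |z.1 - z.2| ≤ t then 1 else 0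

lemma measurableSet_abs_sub_le (t : ℝ) : MeasurableSet {z : ℝ × ℝ | |z.1 - z.2| ≤ t} :=
  measurableSet_le (by fun_prop) measurable_const

lemma measurable_closeKernel (t : ℝ) : Measurable (closeKernel t) :=
  Measurable.ite (measurableSet_abs_sub_le t) measurable_const measurable_const

lemma integral_closeKernel (k : Fin 2) (j : Fin M.p) (t : ℝ) (i l : Fin (M.n k)) (hil : i ≠ l) :
    ∫ ω, closeKernel t (M.Y k j i ω, M.Y k j l ω) ∂M.μ = M.Fdelta k t := by
  have := M.hμ
  have h01 : M.o0 k ≠ M.o1 k := by simp [o0, o1]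
  have hid := (M.identDistrib_Y_Z k j i (M.o0 k)).prodMk (M.identDistrib_Y_Z k j l (M.o1 k))
    ((M.iIndepFun_Y k j).indepFun hil) ((M.iIndepFun_Z k).indepFun h01)
  have hset := hid.measure_mem_eq (measurableSet_abs_sub_le t)
  have hmeas : MeasurableSet {ω | |M.Y k j i ω - M.Y k j l ω| ≤ t} :=
    measurableSet_le ((M.measurable_Y k j i).sub (M.measurable_Y k j l)).abs measurable_const
  have hint : (fun ω => closeKernel t (M.Y k j i ω, M.Y k j l ω)) =
      Set.indicator {ω | |M.Y k j i ω - M.Y k j l ω| ≤ t} 1 := by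
    ext ω
    simp [closeKernel, Set.indicator_apply]
  rw [hint, integral_indicator_one hmeas]
  exact congrArg ENNReal.toReal hset

lemma Fhat_sqrt_mul (k : Fin 2) (j : Fin M.p) (t : ℝ) (ω : Ω) :
    M.Fhat k j (Real.sqrt (M.d0 k j) * t) ω = ((M.n k : ℝ) * (M.n k - 1))⁻¹ *
      ∑ z ∈ (Finset.univ : Finset (Fin (M.n k))).offDiag,
        closeKernel t (M.Y k j z.1 ω, M.Y k j z.2 ω) := by
  have hs := Real.sqrt_pos.2 (M.hd0 k j)
  have hX : ∀ i l, |M.X k i ω j - M.X k l ω j| =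
      Real.sqrt (M.d0 k j) * |M.Y k j i ω - M.Y k j l ω| := by
    intro i l
    rw [← abs_of_pos hs, ← abs_mul]
    simp only [X, Y]
    ring_nf
  unfold Fhat
  simp_rw [hX, mul_le_mul_iff_right₀ hs]
  exact inv_choose_two_mul_sum (fun i l => if |M.Y k j i ω - M.Y k j l ω| ≤ t then (1 : ℝ) else 0)
    fun i l => by rw [abs_sub_comm]

lemma hasSubgaussianMGF_Fhat (k : Fin 2) (j : Fin M.p) (t : ℝ) :
    HasSubgaussianMGF (fun ω => M.Fhat k j (Real.sqrt (M.d0 k j) * t) ω - M.Fdelta k t)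
      (4 * (M.n k / 2 : ℕ) : NNReal)⁻¹ M.μ := by
  have := M.hμ
  have h := hasSubgaussianMGF_uStatistic (M.hn k) (M.iIndepFun_Y k j) (M.measurable_Y k j)
    (measurable_closeKernel t) (fun z => by unfold closeKernel; split_ifs <;> simp)
    (M.integral_closeKernel k j t)
  convert h using 2 with ω
  have h2 : (2 : ℝ) ≤ M.n k := by exact_mod_cast M.hn k
  have hne : (M.n k : ℝ) * (M.n k - 1) ≠ 0 := by
    have : (0 : ℝ) < M.n k - 1 := by linarith
    positivity
  rw [M.Fhat_sqrt_mul, Finset.sum_sub_distrib, mul_sub _ (Finset.sum _ _), Finset.sum_const,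
    nsmul_eq_mul, cast_card_offDiag_univ, Fintype.card_fin, inv_mul_cancel_left₀ hne]

lemma exp_tail_le (k : Fin 2) (ε : ℝ) :
    Real.exp (-ε ^ 2 / (2 * ((4 * (M.n k / 2 : ℕ) : NNReal)⁻¹ : NNReal))) ≤
      Real.exp (-(2 / 3) * M.n0 * ε ^ 2) := by
  have hn := M.hn k
  have hn0 : M.n0 ≤ M.n k := by
    unfold n0
    fin_cases k <;> simp
  have h3 : (M.n0 : ℝ) ≤ 3 * (M.n k / 2 : ℕ) := by
    have : M.n0 ≤ 3 * (M.n k / 2) := by omega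
    exact_mod_cast this
  have hpos : (0 : ℝ) < (M.n k / 2 : ℕ) := by
    have : 0 < M.n k / 2 := by omega
    exact_mod_cast this
  rw [Real.exp_le_exp]
  push_cast
  have : -ε ^ 2 / (2 * (4 * ((M.n k / 2 : ℕ) : ℝ))⁻¹) = -2 * (M.n k / 2 : ℕ) * ε ^ 2 := by
    field_simp
    ring
  rw [this]
  nlinarith [sq_nonneg ε]

lemma Fhat_upper_tail (k : Fin 2) (j : Fin M.p) (t : ℝ) {ε : ℝ} (hε : 0 ≤ ε) :
    M.μ {ω | ε ≤ M.Fhat k j (Real.sqrt (M.d0 k j) * t) ω - M.Fdelta k t} ≤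
      ENNReal.ofReal (Real.exp (-(2 / 3) * M.n0 * ε ^ 2)) := by
  have := M.hμ
  rw [← ofReal_measureReal]
  exact ENNReal.ofReal_le_ofReal
    (((M.hasSubgaussianMGF_Fhat k j t).measure_ge_le hε).trans (M.exp_tail_le k ε))

lemma Fhat_lower_tail (k : Fin 2) (j : Fin M.p) (t : ℝ) {ε : ℝ} (hε : 0 ≤ ε) :
    M.μ {ω | ε ≤ -(M.Fhat k j (Real.sqrt (M.d0 k j) * t) ω - M.Fdelta k t)} ≤
      ENNReal.ofReal (Real.exp (-(2 / 3) * M.n0 * ε ^ 2)) := by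
  have := M.hμ
  rw [← ofReal_measureReal]
  exact ENNReal.ofReal_le_ofReal
    (((M.hasSubgaussianMGF_Fhat k j t).neg.measure_ge_le hε).trans (M.exp_tail_le k ε))

lemma Fhat_mono (k : Fin 2) (j : Fin M.p) (ω : Ω) : Monotone fun t => M.Fhat k j t ω := by
  intro s t hst
  unfold Fhat
  refine mul_le_mul_of_nonneg_left (Finset.sum_le_sum fun i _ => Finset.sum_le_sum fun l _ => ?_)
    (by positivity)
  split_ifs with h1 h2 h3
  · exact le_rfl
  · exact absurd (h2.trans hst) h3
  · exact zero_le_one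
  · exact le_rfl
  · exact le_rfl

lemma Fdelta_mono (k : Fin 2) : Monotone (M.Fdelta k) := by
  have := M.hμ
  intro s t hst
  exact measureReal_mono fun ω (hω : _ ≤ s) => hω.trans hst

lemma exists_one_le_Fhat (k : Fin 2) (j : Fin M.p) (ω : Ω) :
    ∃ t, 0 ≤ t ∧ 1 ≤ M.Fhat k j t ω := by
  let T := ∑ i, ∑ l, |M.X k i ω j - M.X k l ω j|
  have hT : ∀ i l, |M.X k i ω j - M.X k l ω j| ≤ T := fun i l =>
    (Finset.single_le_sum (f := fun l => |M.X k i ω j - M.X k l ω j|)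
      (fun _ _ => abs_nonneg _) (Finset.mem_univ l)).trans
    (Finset.single_le_sum (f := fun i => ∑ l, |M.X k i ω j - M.X k l ω j|)
      (fun _ _ => Finset.sum_nonneg fun _ _ => abs_nonneg _) (Finset.mem_univ i))
  refine ⟨T, Finset.sum_nonneg fun _ _ => Finset.sum_nonneg fun _ _ => abs_nonneg _, ?_⟩
  unfold Fhat
  simp_rw [hT, if_true]
  rw [inv_choose_two_mul_sum (fun _ _ => 1) fun _ _ => rfl, Finset.sum_const,
    nsmul_eq_mul, cast_card_offDiag_univ, Fintype.card_fin]
  have h2 : (2 : ℝ) ≤ M.n k := by exact_mod_cast M.hn k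
  have hpos : (0 : ℝ) < M.n k - 1 := by linarith
  refine le_of_eq ?_
  field_simp

/-- A relative error of `q̂` forces the empirical CDF to deviate from its mean at one of two
deterministic points. -/
lemma deviation_of_qhat {α : ℝ} (hα : α < 1) (k : Fin 2) (j : Fin M.p) {qlo cF εF δ : ℝ}
    (hqlo : 0 < qlo) (hcF : 0 < cF) (hq : qlo ≤ M.qA α k) (hδ : 0 < δ)
    (hδε : δ * M.qA α k ≤ εF)
    (hF : ∀ t : ℝ, |t - M.qA α k| ≤ εF → cF * |t - M.qA α k| ≤ |M.Fdelta k t - α|)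
    {ω : Ω} (hω : δ < |M.qhat α k j ω / Real.sqrt (M.dT α k j) - 1|) :
    cF * qlo * δ ≤ -(M.Fhat k j (Real.sqrt (M.d0 k j) * (M.qA α k * (1 + δ))) ω -
        M.Fdelta k (M.qA α k * (1 + δ))) ∨
      cF * qlo * δ ≤ M.Fhat k j (Real.sqrt (M.d0 k j) * (M.qA α k * (1 - δ))) ω -
        M.Fdelta k (M.qA α k * (1 - δ)) := by
  set q := M.qA α k with hqdef
  set s := Real.sqrt (M.d0 k j) with hsdef
  have hqpos : 0 < q := hqlo.trans_le hq
  have hs : 0 < s := Real.sqrt_pos.2 (M.hd0 k j)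
  have hdT : Real.sqrt (M.dT α k j) = s * q := by
    rw [dT, Real.sqrt_mul (sq_nonneg _), Real.sqrt_sq hqpos.le, mul_comm]
  have hsq : 0 < s * q := mul_pos hs hqpos
  have hqδ : 0 < q * δ := mul_pos hqpos hδ
  have hgap : cF * qlo * δ ≤ cF * (q * δ) := by
    rw [mul_assoc]
    gcongr
  have hbddF : BddBelow {t : ℝ | 0 ≤ t ∧ α ≤ M.Fdelta k t} := ⟨0, fun t ht => ht.1⟩
  have hbddH : BddBelow {t : ℝ | 0 ≤ t ∧ α ≤ M.Fhat k j t ω} := ⟨0, fun t ht => ht.1⟩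
  rw [hdT, lt_abs] at hω
  rcases hω with hω | hω
  · left
    have hlt : s * (q * (1 + δ)) < M.qhat α k j ω := by
      have := (lt_div_iff₀ hsq).1 (by linarith : 1 + δ < M.qhat α k j ω / (s * q))
      linarith
    have hHlt : M.Fhat k j (s * (q * (1 + δ))) ω < α := by
      by_contra! hc
      exact absurd (csInf_le hbddH ⟨by positivity, hc⟩) (not_le.2 hlt)
    have hFge : α ≤ M.Fdelta k (q * (1 + δ)) := by
      have hne : {t : ℝ | 0 ≤ t ∧ α ≤ M.Fdelta k t}.Nonempty := by
        by_contra hne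
        rw [Set.not_nonempty_iff_eq_empty] at hne
        rw [hqdef, qA, hne, Real.sInf_empty] at hqpos
        exact lt_irrefl _ hqpos
      obtain ⟨t, ht, htlt⟩ := exists_lt_of_csInf_lt hne
        (show sInf {t : ℝ | 0 ≤ t ∧ α ≤ M.Fdelta k t} < q * (1 + δ) by
          change q < _
          linarith)
      exact ht.2.trans (M.Fdelta_mono k htlt.le)
    have he : |q * (1 + δ) - q| = q * δ := by
      rw [show q * (1 + δ) - q = q * δ by ring, abs_of_pos hqδ]
    have hslope := hF (q * (1 + δ)) (by rw [he]; linarith)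
    rw [he, abs_of_nonneg (by linarith)] at hslope
    linarith
  · right
    have hlt : M.qhat α k j ω < s * (q * (1 - δ)) := by
      have := (div_lt_iff₀ hsq).1 (by linarith : M.qhat α k j ω / (s * q) < 1 - δ)
      linarith
    obtain ⟨T, hT0, hT1⟩ := M.exists_one_le_Fhat k j ω
    have hne : {t : ℝ | 0 ≤ t ∧ α ≤ M.Fhat k j t ω}.Nonempty := ⟨T, hT0, hα.le.trans hT1⟩
    obtain ⟨t, ht, htlt⟩ := exists_lt_of_csInf_lt hne hlt
    have hHge : α ≤ M.Fhat k j (s * (q * (1 - δ))) ω := ht.2.trans (M.Fhat_mono k j ω htlt.le)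
    have htpos : 0 < q * (1 - δ) := pos_of_mul_pos_right (ht.1.trans_lt htlt) hs.le
    have hFlt : M.Fdelta k (q * (1 - δ)) < α := by
      by_contra! hc
      have : q ≤ q * (1 - δ) := csInf_le hbddF ⟨htpos.le, hc⟩
      linarith
    have he : |q * (1 - δ) - q| = q * δ := by
      rw [show q * (1 - δ) - q = -(q * δ) by ring, abs_neg, abs_of_pos hqδ]
    have hslope := hF (q * (1 - δ)) (by rw [he]; linarith)
    rw [he, abs_of_neg (by linarith)] at hslope
    linarith

lemma n0_pos : (0 : ℝ) < M.n0 := by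
  have h0 := M.hn 0
  have h1 := M.hn 1
  have : 0 < M.n0 := by unfold n0; omega
  exact_mod_cast this

lemma xN_pos : 0 < M.xN := by
  refine Real.log_pos ?_
  have hp : (1 : ℝ) ≤ M.p := by exact_mod_cast M.hp
  have hN : (1 : ℝ) ≤ M.NN := by
    have := M.hn 0
    have : 1 ≤ M.NN := by unfold NN; omega
    exact_mod_cast this
  nlinarith

end Model

/-- exponential deviation bound for the pairwise-difference quantile
estimators.  Under the null `θ_1 = θ_2` and Assumptions (A1)–(A3) (with constants
`q₊, ε_F` as in (A3)), there are constants `C, c > 0` such that for every sufficiently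
large `M` with `M r_D ≤ ε_F/q₊`:
`P( max_{k,j} |q̂_{kj,α}/√d_{kj} − 1| > M r_D ) ≤ C exp(−c M² x_N + log p)`. -/
theorem qhat_exponential_deviation
    {Ω : Type} [MeasurableSpace Ω] (α : ℝ) (hα : 0 < α ∧ α < 1)
    (Ms : ℕ → Model Ω)
    (hH0 : ∀ ν, (Ms ν).H0)
    (hA1 : A1 Ms) (hA2 : A2 Ms)
    (qlo qhi cF CF εF : ℝ)
    (hq : 0 < qlo ∧ qlo < qhi ∧ 0 < cF ∧ 0 < εF ∧
      ∀ ν k, (qlo ≤ (Ms ν).qA α k ∧ (Ms ν).qA α k ≤ qhi) ∧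
        ∀ t : ℝ, |t - (Ms ν).qA α k| ≤ εF →
          cF * |t - (Ms ν).qA α k| ≤ |(Ms ν).Fdelta k t - α| ∧
          |(Ms ν).Fdelta k t - α| ≤ CF * |t - (Ms ν).qA α k|) :
    ∃ C c M₀ : ℝ, 0 < C ∧ 0 < c ∧ 0 < M₀ ∧
      ∀ ν : ℕ, ∀ Mc : ℝ, M₀ ≤ Mc → Mc * (Ms ν).rD ≤ εF / qhi →
        (Ms ν).μ {ω | Mc * (Ms ν).rD <
            ⨆ k : Fin 2, ⨆ j : Fin (Ms ν).p,
              |(Ms ν).qhat α k j ω / Real.sqrt ((Ms ν).dT α k j) - 1|}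
          ≤ ENNReal.ofReal
              (C * Real.exp (-c * Mc ^ 2 * (Ms ν).xN + Real.log ((Ms ν).p))) := by
  obtain ⟨hqlo, hqlt, hcF, -, hF⟩ := hq
  refine ⟨4, 2 / 3 * (cF * qlo) ^ 2, 1, by norm_num, by positivity, one_pos, ?_⟩
  intro ν Mc hMc hMr
  let M := Ms ν
  change M.μ {ω | Mc * M.rD < ⨆ k : Fin 2, ⨆ j : Fin M.p,
    |M.qhat α k j ω / Real.sqrt (M.dT α k j) - 1|} ≤ ENNReal.ofReal
      (4 * Real.exp (-(2 / 3 * (cF * qlo) ^ 2) * Mc ^ 2 * M.xN + Real.log M.p))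
  have hrD : 0 < M.rD := Real.sqrt_pos.2 (div_pos M.xN_pos M.n0_pos)
  set δ := Mc * M.rD with hδdef
  have hδ : 0 < δ := mul_pos (one_pos.trans_le hMc) hrD
  have hε : 0 ≤ cF * qlo * δ := by positivity
  have hp : (0 : ℝ) < M.p := by exact_mod_cast M.hp
  have hδq : ∀ k, δ * M.qA α k ≤ εF := fun k =>
    (mul_le_mul_of_nonneg_left (hF ν k).1.2 hδ.le).trans
      ((le_div_iff₀ (hqlo.trans hqlt)).1 hMr)
  let A : Fin 2 → Fin M.p → Set Ω := fun k j =>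
    {ω | cF * qlo * δ ≤ -(M.Fhat k j (Real.sqrt (M.d0 k j) * (M.qA α k * (1 + δ))) ω -
        M.Fdelta k (M.qA α k * (1 + δ)))}
  let B : Fin 2 → Fin M.p → Set Ω := fun k j =>
    {ω | cF * qlo * δ ≤ M.Fhat k j (Real.sqrt (M.d0 k j) * (M.qA α k * (1 - δ))) ω -
        M.Fdelta k (M.qA α k * (1 - δ))}
  have hsub : {ω | δ < ⨆ k : Fin 2, ⨆ j : Fin M.p,
      |M.qhat α k j ω / Real.sqrt (M.dT α k j) - 1|} ⊆ ⋃ k, ⋃ j, (A k j ∪ B k j) := by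
    intro ω hω
    have : Nonempty (Fin M.p) := ⟨M.j0⟩
    obtain ⟨k, hk⟩ := exists_lt_of_lt_ciSup (Set.mem_ofPred_eq ▸ hω)
    obtain ⟨j, hj⟩ := exists_lt_of_lt_ciSup hk
    exact Set.mem_iUnion₂.2 ⟨k, j, M.deviation_of_qhat hα.2 k j hqlo hcF (hF ν k).1.1 hδ (hδq k)
      (fun t ht => ((hF ν k).2 t ht).1) hj⟩
  set e := Real.exp (-(2 / 3) * M.n0 * (cF * qlo * δ) ^ 2) with hedef
  have hAB : ∀ k j, M.μ (A k j ∪ B k j) ≤ 2 * ENNReal.ofReal e := fun k j =>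
    (measure_union_le _ _).trans ((add_le_add (M.Fhat_lower_tail k j _ hε)
      (M.Fhat_upper_tail k j _ hε)).trans_eq (two_mul _).symm)
  have hexp : -(2 / 3) * M.n0 * (cF * qlo * δ) ^ 2 =
      -(2 / 3 * (cF * qlo) ^ 2) * Mc ^ 2 * M.xN := by
    have hr2 : M.rD ^ 2 = M.xN / M.n0 := Real.sq_sqrt (div_pos M.xN_pos M.n0_pos).le
    have := M.n0_pos.ne'
    rw [hδdef, mul_pow, mul_pow Mc, hr2]
    field_simp
  calc M.μ {ω | δ < ⨆ k : Fin 2, ⨆ j : Fin M.p,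
          |M.qhat α k j ω / Real.sqrt (M.dT α k j) - 1|}
      ≤ M.μ (⋃ k, ⋃ j, (A k j ∪ B k j)) := measure_mono hsub
    _ ≤ ∑ k, M.μ (⋃ j, (A k j ∪ B k j)) := measure_iUnion_fintype_le _ _
    _ ≤ ∑ k, ∑ j, M.μ (A k j ∪ B k j) :=
        Finset.sum_le_sum fun k _ => measure_iUnion_fintype_le _ _
    _ ≤ ∑ _k : Fin 2, ∑ _j : Fin M.p, 2 * ENNReal.ofReal e :=
        Finset.sum_le_sum fun k _ => Finset.sum_le_sum fun j _ => hAB k j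
    _ = ENNReal.ofReal (4 * (e * M.p)) := by
        rw [show 4 * (e * M.p) = 2 * (M.p * (2 * e)) by ring,
          ENNReal.ofReal_mul (by norm_num), ENNReal.ofReal_mul hp.le,
          ENNReal.ofReal_mul (by norm_num)]
        simp
    _ = _ := by rw [hedef, hexp, Real.exp_add, Real.exp_log hp]

end PDQ

end
end

section
/- Let Z ~ N_p(0, I_p) and R_p = ‖Z‖. For every constant c > 0 there exists a constant C_c < ∞, independent of p, such that for all p ≥ 3, sup_{0 < t ≤ 1} t^{−2} P( R_p ≤ c t p^{1/2} ) ≤ C_c. -/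
open MeasureTheory ProbabilityTheory

noncomputable section

/-- The moment generating function of the `χ²₁` distribution. For `1 / 2 ≤ s` the integral diverges
and both sides take the value `0`. -/
lemma mgf_sq_gaussianReal (s : ℝ) :
    mgf (fun x : ℝ ↦ x ^ 2) (gaussianReal 0 1) s = √(1 / (1 - 2 * s)) := by
  have hexp (x : ℝ) : gaussianPDFReal 0 1 x • Real.exp (s * x ^ 2)
      = (√(2 * Real.pi))⁻¹ * Real.exp (-(1 / 2 - s) * x ^ 2) := by
    simp only [gaussianPDFReal, smul_eq_mul, NNReal.coe_one, mul_one, sub_zero]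
    rw [mul_assoc, ← Real.exp_add]
    congr 2
    ring
  rw [mgf, integral_gaussianReal_eq_integral_smul one_ne_zero]
  simp_rw [hexp]
  rw [integral_const_mul, integral_gaussian, ← Real.sqrt_inv, ← Real.sqrt_mul (by positivity)]
  congr 1
  field_simp

/-- Chernoff bound for the lower tail of the `χ²_p` distribution. -/
lemma measureReal_sum_sq_gaussian_le {Ω ι : Type*} [MeasurableSpace Ω] [Fintype ι]
    {μ : Measure Ω} [IsProbabilityMeasure μ] {Z : ι → Ω → ℝ}
    (hZm : ∀ i, Measurable (Z i)) (hZi : iIndepFun Z μ)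
    (hZ : ∀ i, μ.map (Z i) = gaussianReal 0 1) {a : ℝ} (ha : 0 < a) :
    μ.real {ω | ∑ i, Z i ω ^ 2 ≤ a * Fintype.card ι} ≤
      √(Real.exp 1 * a) ^ Fintype.card ι := by
  set s : ℝ := -(1 / (2 * a)) with hs_def
  have hs : s ≤ 0 := by rw [hs_def, neg_nonpos]; positivity
  have hsq_meas (i : ι) : Measurable (fun ω ↦ Z i ω ^ 2) := (hZm i).pow_const 2
  have hindep : iIndepFun (fun i ω ↦ Z i ω ^ 2) μ :=
    hZi.comp (fun _ x ↦ x ^ 2) (fun _ ↦ measurable_id.pow_const 2)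
  have hmgf (i : ι) : mgf (fun ω ↦ Z i ω ^ 2) μ s = √(1 / (1 - 2 * s)) := by
    rw [← mgf_sq_gaussianReal s, ← hZ i, mgf_map (hZm i).aemeasurable (by fun_prop)]
    rfl
  have hint : Integrable (fun ω ↦ Real.exp (s * (∑ i, fun ω ↦ Z i ω ^ 2) ω)) μ := by
    refine .of_bound (by fun_prop) 1 (.of_forall fun ω ↦ ?_)
    rw [Real.norm_eq_abs, Real.abs_exp, Real.exp_le_one_iff, Finset.sum_apply]
    exact mul_nonpos_of_nonpos_of_nonneg hs (by positivity)
  have hchernoff := measure_le_le_exp_mul_mgf (a * Fintype.card ι) hs hint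
  rw [hindep.mgf_sum hsq_meas] at hchernoff
  simp only [hmgf, Finset.prod_const, Finset.card_univ, Finset.sum_apply] at hchernoff
  refine hchernoff.trans ?_
  have hexp : Real.exp (-s * (a * Fintype.card ι)) = √(Real.exp 1) ^ Fintype.card ι := by
    rw [← Real.exp_half, ← Real.exp_nat_mul, hs_def]
    congr 1
    field_simp
  rw [hexp, ← mul_pow, Real.sqrt_mul (Real.exp_pos 1).le]
  gcongr
  rw [hs_def, div_le_iff₀ (by linarith)]
  have : a * (1 - 2 * -(1 / (2 * a))) = a + 1 := by field_simp; ring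
  linarith

/-- Gaussian small-ball estimate.  For `Z ~ N_p(0, I_p)` (modelled by
`p` i.i.d. standard Gaussian coordinates) and `R_p = ‖Z‖`: for every `c > 0` there is a
constant `C_c < ∞`, independent of `p`, such that for all `p ≥ 3`,
`sup_{0 < t ≤ 1} t^{−2} P(R_p ≤ c t √p) ≤ C_c`. -/
theorem gaussian_small_ball :
    ∀ c : ℝ, 0 < c → ∃ Cc : ℝ,
      ∀ (Ω : Type) (_ : MeasurableSpace Ω) (μ : Measure Ω), IsProbabilityMeasure μ →
      ∀ (p : ℕ), 3 ≤ p →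
      ∀ (Z : Fin p → Ω → ℝ),
        (∀ i, Measurable (Z i)) →
        iIndepFun Z μ →
        (∀ i, μ.map (Z i) = gaussianReal 0 1) →
        ∀ t : ℝ, 0 < t → t ≤ 1 →
          t ^ (-2 : ℤ) *
            (μ {ω | Real.sqrt (∑ i, Z i ω ^ 2) ≤ c * t * Real.sqrt p}).toReal ≤ Cc := by
  intro c hc
  refine ⟨Real.exp 1 * c ^ 2, fun Ω _ μ _ p hp Z hZm hZi hZ t ht _ ↦ ?_⟩
  have hset : {ω | √(∑ i, Z i ω ^ 2) ≤ c * t * √p} =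
      {ω | ∑ i, Z i ω ^ 2 ≤ (c * t) ^ 2 * Fintype.card (Fin p)} := by
    ext ω
    simp only [Set.mem_ofPred_eq, Fintype.card_fin]
    rw [Real.sqrt_le_left (by positivity), mul_pow (c * t), Real.sq_sqrt (Nat.cast_nonneg p)]
  have hprob : μ.real {ω | √(∑ i, Z i ω ^ 2) ≤ c * t * √p} ≤ Real.exp 1 * (c * t) ^ 2 := by
    rcases le_total (Real.exp 1 * (c * t) ^ 2) 1 with hle | hge
    · rw [hset]
      refine (measureReal_sum_sq_gaussian_le hZm hZi hZ (by positivity)).trans ?_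
      rw [Fintype.card_fin]
      calc √(Real.exp 1 * (c * t) ^ 2) ^ p
          ≤ √(Real.exp 1 * (c * t) ^ 2) ^ 2 :=
            pow_le_pow_of_le_one (Real.sqrt_nonneg _) (Real.sqrt_le_one.mpr hle) (by lia)
        _ = Real.exp 1 * (c * t) ^ 2 := Real.sq_sqrt (by positivity)
    · exact measureReal_le_one.trans hge
  rw [zpow_neg, inv_mul_le_iff₀ (by positivity)]
  refine hprob.trans_eq ?_
  norm_cast
  ring

end
end
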